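/- If T is a finite tree and k ≥ 1 is an integer, then c_{H,k}(T) ≤ ⌊diam(T)/4⌋ + 1. -/

import Mathlib

namespace CopsRobber

open SimpleGraph

/-- A strategy for `d` cops on vertex set `V`: initial positions, together with a move
function taking the list of observations made so far (most recent first; the observation in a
round is `some r` if the robber, located at `r`, was visible to the cops at the start of that
round, and `none` if he was invisible) and the current cop positions, and returning the cops'
new positions. -/
structure CopStrategy (V : Type) (d : ℕ) where
  init : Fin d → V
  move : List (Option V) → (Fin d → V) → Fin d → V

/-- A strategy for the omniscient robber against `d` cops: a starting vertex chosen after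
seeing the cops' initial positions, and a move function which may depend on the entire history
of the game (the list of past (cop positions, robber position) states, most recent first),
the cops' new positions, and the robber's current position. -/
structure RobberStrategy (V : Type) (d : ℕ) where
  init : (Fin d → V) → V
  move : List ((Fin d → V) × V) → (Fin d → V) → V → V

/-- A cop strategy is legal if every cop always stays put or moves along an edge of `G`. -/
def CopStrategy.Legal {V : Type} (G : SimpleGraph V) {d : ℕ} (S : CopStrategy V d) : Prop :=
  ∀ h p i, S.move h p i = p i ∨ G.Adj (p i) (S.move h p i)

/-- A robber strategy is legal if the robber always stays put or moves along an edge of `G`. -/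
def RobberStrategy.Legal {V : Type} (G : SimpleGraph V) {d : ℕ} (R : RobberStrategy V d) :
    Prop :=
  ∀ h c r, R.move h c r = r ∨ G.Adj r (R.move h c r)

open Classical in
/-- The cops' observation: the robber's position if he is visible, `none` otherwise. -/
noncomputable def observe {V : Type} {d : ℕ} (vis : (Fin d → V) → V → Prop)
    (c : Fin d → V) (r : V) : Option V :=
  if vis c r then some r else none

/-- The play of the game determined by a cop strategy and a robber strategy, with visibility
predicate `vis`: at each stage we record the current (cop positions, robber position) together
with the list of past observations and the list of past states. In each round the cops observe
the robber (according to `vis`), move, and then the robber moves. -/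
noncomputable def play {V : Type} {d : ℕ} (vis : (Fin d → V) → V → Prop)
    (S : CopStrategy V d) (R : RobberStrategy V d) :
    ℕ → ((Fin d → V) × V) × (List (Option V) × List ((Fin d → V) × V))
  | 0 => ((S.init, R.init S.init), ([], []))
  | n + 1 =>
    let st := play vis S R n
    let c := st.1.1
    let r := st.1.2
    let o := observe vis c r
    let c' := S.move (o :: st.2.1) c
    let r' := R.move ((c, r) :: st.2.2) c' r
    ((c', r'), (o :: st.2.1, (c, r) :: st.2.2))

/-- The cops' positions at the end of round `n`. -/
noncomputable def copPos {V : Type} {d : ℕ} (vis : (Fin d → V) → V → Prop)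
    (S : CopStrategy V d) (R : RobberStrategy V d) (n : ℕ) : Fin d → V :=
  (play vis S R n).1.1

/-- The robber's position at the end of round `n`. -/
noncomputable def robPos {V : Type} {d : ℕ} (vis : (Fin d → V) → V → Prop)
    (S : CopStrategy V d) (R : RobberStrategy V d) (n : ℕ) : V :=
  (play vis S R n).1.2

/-- The cops capture the robber in the given play: at some point (either at the end of a round,
or just after the cops' move within a round) some cop occupies the robber's vertex. -/
def Captures {V : Type} {d : ℕ} (vis : (Fin d → V) → V → Prop)
    (S : CopStrategy V d) (R : RobberStrategy V d) : Prop :=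
  ∃ n i, copPos vis S R n i = robPos vis S R n ∨ copPos vis S R (n + 1) i = robPos vis S R n

/-- A winning strategy for `d` cops on `G` with visibility predicate `vis`: a legal cop
strategy capturing the robber against every legal robber strategy (the robber is omniscient,
so the cops must succeed against all robber behaviours). -/
def WinningCopStrategy {V : Type} (G : SimpleGraph V) {d : ℕ}
    (vis : (Fin d → V) → V → Prop) (S : CopStrategy V d) : Prop :=
  S.Legal G ∧ ∀ R : RobberStrategy V d, R.Legal G → Captures vis S R

/-- The minimum number of cops having a winning strategy on `G`, for the game with visibility
predicate `vis`. -/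
noncomputable def copNumberVis {V : Type} (G : SimpleGraph V)
    (vis : ∀ d : ℕ, (Fin d → V) → V → Prop) : ℕ :=
  sInf {d | ∃ S : CopStrategy V d, WinningCopStrategy G (vis d) S}

/-- The classical cop number `c(G)`: the robber is always visible. -/
noncomputable def copNumber {V : Type} (G : SimpleGraph V) : ℕ :=
  copNumberVis G fun _ _ _ => True

/-- The 0-visibility cop number `c₀(G)`: the robber is never visible. -/
noncomputable def zeroVisCopNumber {V : Type} (G : SimpleGraph V) : ℕ :=
  copNumberVis G fun _ _ _ => False

/-- The `k`-hyperopic cop number `c_{H,k}(G)`: the robber at `r` is invisible exactly when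
every cop `c` satisfies `1 ≤ d(r,c) ≤ k`. -/
noncomputable def hyperopicCopNumber {V : Type} (G : SimpleGraph V) (k : ℕ) : ℕ :=
  copNumberVis G fun _ c r => ¬ ∀ i, 1 ≤ G.dist r (c i) ∧ G.dist r (c i) ≤ k

section Tree

variable {V : Type} {T : SimpleGraph V}

/-- For an edge `p w` of a tree, the component of `w` after deletion of that edge. -/
def branch (T : SimpleGraph V) (p w : V) : Set V :=
  {x | T.dist x p = T.dist x w + 1}

theorem mem_branch {p w x : V} : x ∈ branch T p w ↔ T.dist x p = T.dist x w + 1 :=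
  Iff.rfl

theorem mem_branch_or (hT : T.IsTree) {p w : V} (h : T.Adj p w) (x : V) :
    x ∈ branch T p w ∨ x ∈ branch T w p :=
  hT.dist_eq_dist_add_one_of_adj x h

theorem notMem_branch_swap {p w x : V} (hx : x ∈ branch T p w) : x ∉ branch T w p := by
  simp only [mem_branch] at *
  omega

theorem exists_adj_dist_lt (hT : T.IsTree) {x w : V} (h : x ≠ w) :
    ∃ y, T.Adj x y ∧ T.dist x w = T.dist y w + 1 := by
  obtain ⟨q, hq⟩ := hT.connected.exists_walk_length_eq_dist x w
  cases q with
  | nil => exact absurd rfl h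
  | @cons _ y _ hxy q =>
    refine ⟨y, hxy, ?_⟩
    have h1 := dist_le q
    rw [Walk.length_cons] at hq
    rcases hT.dist_eq_dist_add_one_of_adj w hxy with h2 | h2 <;>
      simp only [dist_comm (u := w)] at h2 <;> omega

theorem adj_dist_lt_unique (hT : T.IsTree) {x p y z : V} (hy : T.Adj x y) (hz : T.Adj x z)
    (hyp : T.dist x p = T.dist y p + 1) (hzp : T.dist x p = T.dist z p + 1) : y = z := by
  obtain ⟨q, hq⟩ := hT.connected.exists_walk_length_eq_dist y p
  obtain ⟨q', hq'⟩ := hT.connected.exists_walk_length_eq_dist z p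
  have h1 : (Walk.cons hy q).IsPath :=
    Walk.isPath_of_length_eq_dist _ (by rw [Walk.length_cons, hq, hyp])
  have h2 : (Walk.cons hz q').IsPath :=
    Walk.isPath_of_length_eq_dist _ (by rw [Walk.length_cons, hq', hzp])
  have h3 : Walk.cons hy q = Walk.cons hz q' :=
    congrArg Subtype.val ((hT.isAcyclic.subsingleton_path x p).elim ⟨_, h1⟩ ⟨_, h2⟩)
  simpa using congrArg (fun W => W.getVert 1) h3

/-- Leaving a branch is only possible from its root. -/
theorem eq_of_adj_of_notMem_branch (hT : T.IsTree) {p w x y : V} (h : T.Adj p w)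
    (hx : x ∈ branch T p w) (hxy : T.Adj x y) (hy : y ∉ branch T p w) : x = w := by
  have hy' := (mem_branch_or hT h y).resolve_left hy
  rw [mem_branch] at hx hy'
  by_contra hxw
  obtain ⟨z, hxz, hz⟩ := exists_adj_dist_lt hT hxw
  have hzp := hT.dist_eq_dist_add_one_of_adj z h
  have h1 := hT.dist_eq_dist_add_one_of_adj p hxz
  have h2 := hT.dist_eq_dist_add_one_of_adj p hxy
  have h3 := hT.dist_eq_dist_add_one_of_adj w hxy
  simp only [dist_comm (u := p), dist_comm (u := w)] at h1 h2 h3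
  have := adj_dist_lt_unique hT (p := p) hxy hxz (by omega) (by omega)
  subst this
  omega

theorem exists_mem_branch_child (hT : T.IsTree) {p w x : V}
    (hx : x ∈ branch T p w) (hxw : x ≠ w) :
    ∃ v, T.Adj w v ∧ v ≠ p ∧ x ∈ branch T w v := by
  obtain ⟨v, hv, hd⟩ := exists_adj_dist_lt hT hxw.symm
  simp only [dist_comm (v := x)] at hd
  refine ⟨v, hv, ?_, hd⟩
  rintro rfl
  exact notMem_branch_swap hx hd

theorem branch_child_subset (hT : T.IsTree) {p w v : V} (hp : T.Adj p w) (hv : T.Adj w v)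
    (hvp : v ≠ p) : branch T w v ⊆ branch T p w := by
  intro x hx
  refine (mem_branch_or hT hp x).resolve_right fun hx' => hvp ?_
  rw [mem_branch] at hx hx'
  simp only [dist_comm (u := x)] at hx hx'
  exact adj_dist_lt_unique hT hv hp.symm hx hx'

theorem dist_add_dist_lt_length (hT : T.IsTree) {u v x b : V} (h : T.Adj u v) (q : T.Walk x b)
    (hx : x ∈ branch T v u) (hb : b ∈ branch T u v) :
    T.dist x u + T.dist v b < q.length := by
  induction q with
  | nil => exact absurd hb (notMem_branch_swap hx)
  | @cons x y b hxy q ih =>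
    rw [Walk.length_cons]
    by_cases hy : y ∈ branch T v u
    · have h1 := ih hy hb
      have h2 := hT.dist_eq_dist_add_one_of_adj u hxy
      simp only [dist_comm (u := u)] at h2
      omega
    · have hxu := eq_of_adj_of_notMem_branch hT h.symm hx hxy hy
      have hyv := eq_of_adj_of_notMem_branch hT h
        ((mem_branch_or hT h y).resolve_right hy) hxy.symm (notMem_branch_swap hx)
      subst hxu hyv
      have := dist_le q
      simp only [dist_self]
      omega

theorem dist_add_dist_lt_dist (hT : T.IsTree) {u v x b : V} (h : T.Adj u v)
    (hx : x ∈ branch T v u) (hb : b ∈ branch T u v) :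
    T.dist x u + T.dist v b < T.dist x b := by
  obtain ⟨q, hq⟩ := hT.connected.exists_walk_length_eq_dist x b
  exact hq ▸ dist_add_dist_lt_length hT h q hx hb

/-- The two branches at a middle edge of a longest path of a tree have height at most half the
diameter. -/
theorem exists_central_edge [Finite V] (hT : T.IsTree) (hD : T.diam ≠ 0) :
    ∃ u v, T.Adj u v ∧ (∀ x ∈ branch T v u, T.dist x u ≤ T.diam / 2) ∧
      ∀ x ∈ branch T u v, T.dist x v ≤ T.diam / 2 := by
  have := hT.connected.nonempty
  have htop := ediam_ne_top_of_diam_ne_zero hD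
  obtain ⟨a, b, hab⟩ := T.exists_dist_eq_diam
  obtain ⟨q, hq⟩ := hT.connected.exists_walk_length_eq_dist a b
  set D := T.diam
  have hadj := q.adj_getVert_succ (i := D / 2) (by omega)
  have hau := dist_le (q.take (D / 2))
  have hvb := dist_le (q.drop (D / 2 + 1))
  rw [Walk.take_length] at hau
  rw [Walk.drop_length] at hvb
  generalize q.getVert (D / 2) = u at hadj hau
  generalize q.getVert (D / 2 + 1) = v at hadj hvb
  have h1 : T.dist a b ≤ T.dist a v + T.dist v b := hT.connected.dist_triangle
  have h2 : T.dist a b ≤ T.dist a u + T.dist u b := hT.connected.dist_triangle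
  have ha : a ∈ branch T v u := (mem_branch_or hT hadj a).resolve_left fun h => by
    rw [mem_branch] at h
    omega
  have hb : b ∈ branch T u v := (mem_branch_or hT hadj b).resolve_right fun h => by
    rw [mem_branch, dist_comm, dist_comm (v := u)] at h
    omega
  have h3 := dist_add_dist_lt_dist hT hadj ha hb
  have h4 := hT.dist_eq_dist_add_one_of_adj b hadj
  simp only [dist_comm (u := b)] at h4
  refine ⟨u, v, hadj, fun x hx => ?_, fun x hx => ?_⟩
  · have h5 := dist_add_dist_lt_dist hT hadj hx hb
    have h6 : T.dist x b ≤ D := dist_le_diam htop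
    omega
  · have h5 := dist_add_dist_lt_dist hT hadj.symm hx ha
    have h6 : T.dist x a ≤ D := dist_le_diam htop
    rw [dist_comm (u := u)] at h5
    omega

end Tree

section LazyWalk

variable {V : Type} {T : SimpleGraph V} {d : ℕ}

/-- A sequence of vertices in which consecutive ones are equal or adjacent. -/
def IsLazyWalk (T : SimpleGraph V) (r : ℕ → V) : Prop :=
  ∀ t, r (t + 1) = r t ∨ T.Adj (r t) (r (t + 1))

theorem IsLazyWalk.shift {r : ℕ → V} (hr : IsLazyWalk T r) (n : ℕ) :
    IsLazyWalk T fun t => r (n + t) :=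
  fun t => hr (n + t)

/-- The cops moving along `c` meet the robber moving along `r` within the first `n` rounds. -/
def Caught (c : ℕ → Fin d → V) (r : ℕ → V) (n : ℕ) : Prop :=
  ∃ t < n, ∃ i, c t i = r t ∨ c (t + 1) i = r t

theorem Caught.mono {c : ℕ → Fin d → V} {r : ℕ → V} {m n : ℕ} (h : Caught c r m) (hmn : m ≤ n) :
    Caught c r n :=
  let ⟨t, ht, i, hi⟩ := h
  ⟨t, ht.trans_le hmn, i, hi⟩

/-- Follow `f` up to time `n`, then `g`. -/
def splice {α : Type} (n : ℕ) (f g : ℕ → α) (t : ℕ) : α :=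
  if t ≤ n then f t else g (t - n)

theorem splice_of_le {α : Type} {n t : ℕ} (f g : ℕ → α) (h : t ≤ n) : splice n f g t = f t :=
  if_pos h

theorem splice_add {α : Type} {n : ℕ} {f g : ℕ → α} (h : g 0 = f n) (t : ℕ) :
    splice n f g (n + t) = g t := by
  rcases t with _ | t
  · simp [splice, h]
  · simp [splice]

theorem isLazyWalk_splice {n : ℕ} {f g : ℕ → Fin d → V} (h : g 0 = f n)
    (hf : ∀ i, IsLazyWalk T fun t => f t i) (hg : ∀ i, IsLazyWalk T fun t => g t i) (i : Fin d) :
    IsLazyWalk T fun t => splice n f g t i := by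
  intro t
  rcases lt_or_ge t n with ht | ht
  · simpa only [splice_of_le f g ht.le, splice_of_le f g (Nat.succ_le_of_lt ht)] using hf i t
  · obtain ⟨s, rfl⟩ := Nat.exists_eq_add_of_le ht
    simpa only [add_assoc, splice_add h] using hg i s

theorem Caught.splice_left {n : ℕ} {f : ℕ → Fin d → V} {r : ℕ → V} (h : Caught f r n)
    (g : ℕ → Fin d → V) : Caught (splice n f g) r n := by
  obtain ⟨t, ht, i, hi⟩ := h
  refine ⟨t, ht, i, ?_⟩
  rwa [splice_of_le f g ht.le, splice_of_le f g (Nat.succ_le_of_lt ht)]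

theorem Caught.splice_right {n m : ℕ} {f g : ℕ → Fin d → V} {r : ℕ → V} (h : g 0 = f n)
    (hc : Caught g (fun t => r (n + t)) m) : Caught (splice n f g) r (n + m) := by
  obtain ⟨t, ht, i, hi⟩ := hc
  refine ⟨n + t, by omega, i, ?_⟩
  rwa [splice_add h, add_assoc, splice_add h]

/-- A robber who starts in a branch and keeps off its root stays in it. -/
theorem mem_branch_of_ne (hT : T.IsTree) {p w : V} (h : T.Adj p w) {r : ℕ → V}
    (hr : IsLazyWalk T r) (h0 : r 0 ∈ branch T p w) {n : ℕ} (hw : ∀ t < n, r t ≠ w) :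
    ∀ t ≤ n, r t ∈ branch T p w := by
  intro t
  induction t with
  | zero => exact fun _ => h0
  | succ t ih =>
    intro ht
    have h1 := ih (by omega)
    rcases hr t with h2 | h2
    · rwa [h2]
    · by_contra h3
      exact hw t (by omega) (eq_of_adj_of_notMem_branch hT h h1 h2 h3)

/-- A robber who starts in a branch and keeps off the parent of its root stays in it. -/
theorem mem_branch_of_ne_parent (hT : T.IsTree) {p w : V} (h : T.Adj p w) {r : ℕ → V}
    (hr : IsLazyWalk T r) (h0 : r 0 ∈ branch T p w) {n : ℕ} (hp : ∀ t < n, r t ≠ p) :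
    ∀ t < n, r t ∈ branch T p w := by
  intro t
  induction t with
  | zero => exact fun _ => h0
  | succ t ih =>
    intro ht
    have h1 := ih (by omega)
    rcases hr t with h2 | h2
    · rwa [h2]
    · by_contra h3
      exact hp (t + 1) ht (eq_of_adj_of_notMem_branch hT h.symm
        ((mem_branch_or hT h _).resolve_left h3) h2.symm (notMem_branch_swap h1))

/-- A robber confined to a branch and keeping off its root stays in the branch of a child. -/
theorem exists_child_forall_mem (hT : T.IsTree) {p w : V} {r : ℕ → V}
    (hr : IsLazyWalk T r) {n : ℕ} (hn : 0 < n) (hB : ∀ t < n, r t ∈ branch T p w)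
    (hw : ∀ t < n, r t ≠ w) :
    ∃ v, T.Adj w v ∧ v ≠ p ∧ ∀ t < n, r t ∈ branch T w v := by
  obtain ⟨v, hv, hvp, h0⟩ := exists_mem_branch_child hT (hB 0 hn) (hw 0 hn)
  exact ⟨v, hv, hvp, mem_branch_of_ne_parent hT hv hr h0 hw⟩

/-- A cop occupying `w` at every even time keeps an uncaught robber off `w`. -/
theorem ne_of_not_caught {c : ℕ → Fin d → V} {r : ℕ → V} {w : V} {i : Fin d} {n : ℕ}
    (hc : ∀ t, c (2 * t) i = w) (h : ¬ Caught c r n) : ∀ t < n, r t ≠ w := by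
  rintro t ht rfl
  refine h ⟨t, ht, i, ?_⟩
  rcases Nat.even_or_odd' t with ⟨s, hs | hs⟩
  · exact .inl (by conv_lhs => rw [hs, hc])
  · exact .inr (by conv_lhs => rw [hs, show 2 * s + 1 + 1 = 2 * (s + 1) by ring, hc])

end LazyWalk

section Sweeps

variable {V : Type} {T : SimpleGraph V} {d : ℕ}

/-- From every position satisfying `Q`, a team of `d` cops can, in an even number of rounds and
with its position satisfying `Q` at every even time, catch every invisible robber who stays in a
single member of `F`. -/
def Sweeps (T : SimpleGraph V) (d : ℕ) (Q : (Fin d → V) → Prop) (F : Set (Set V)) : Prop :=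
  ∀ c₀, Q c₀ → ∃ (n : ℕ) (c : ℕ → Fin d → V), c 0 = c₀ ∧ (∀ i, IsLazyWalk T fun t => c t i) ∧
    (∀ t, Q (c (2 * t))) ∧
    ∀ r, IsLazyWalk T r → ∀ B ∈ F, (∀ t < 2 * n, r t ∈ B) → Caught c r (2 * n)

theorem Sweeps.insert {Q : (Fin d → V) → Prop} {B : Set V} {F : Set (Set V)}
    (hB : Sweeps T d Q {B}) (hF : Sweeps T d Q F) : Sweeps T d Q (insert B F) := by
  intro c₀ h₀
  obtain ⟨n, c, hc0, hc, hQ, hcatch⟩ := hB c₀ h₀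
  obtain ⟨n', c', hc0', hc', hQ', hcatch'⟩ := hF (c (2 * n)) (hQ n)
  refine ⟨n + n', splice (2 * n) c c', ?_, isLazyWalk_splice hc0' hc hc', fun t => ?_, ?_⟩
  · rw [splice_of_le _ _ (Nat.zero_le _), hc0]
  · rcases le_total t n with ht | ht
    · rw [splice_of_le _ _ (by omega)]
      exact hQ t
    · obtain ⟨s, rfl⟩ := Nat.exists_eq_add_of_le ht
      rw [mul_add, splice_add hc0']
      exact hQ' s
  · rintro r hr A (rfl | hA) hrA
    · exact ((hcatch r hr A rfl fun t ht => hrA t (by omega)).splice_left c').mono (by omega)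
    · rw [mul_add]
      exact (hcatch' _ (hr.shift _) A hA fun t ht => hrA _ (by omega)).splice_right hc0'

theorem sweeps_of_forall [Finite V] {Q : (Fin d → V) → Prop} {F : Set (Set V)}
    (h : ∀ B ∈ F, Sweeps T d Q {B}) : Sweeps T d Q F := by
  induction F, F.toFinite using Set.Finite.induction_on with
  | empty => exact fun c₀ h₀ => ⟨0, fun _ => c₀, rfl, fun i t => .inl rfl, fun _ => h₀, by simp⟩
  | insert _ _ ih =>
    exact (h _ (Set.mem_insert _ _)).insert (ih fun B hB => h B (Set.mem_insert_of_mem _ hB))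

/-- One cop can be brought to any vertex `w` in an even number of rounds. -/
theorem exists_lazyWalk_to (hT : T.IsTree) (c₀ : Fin (d + 1) → V) (w : V) :
    ∃ (n : ℕ) (c : ℕ → Fin (d + 1) → V), c 0 = c₀ ∧ (∀ i, IsLazyWalk T fun t => c t i) ∧
      c (2 * n) 0 = w := by
  obtain ⟨q⟩ := hT.connected.preconnected (c₀ 0) w
  refine ⟨q.length, fun t => Function.update c₀ 0 (q.getVert t), by simp, fun i t => ?_, ?_⟩
  · rcases eq_or_ne i 0 with rfl | hi
    · rcases lt_or_ge t q.length with ht | ht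
      · exact .inr (by simpa using q.adj_getVert_succ ht)
      · exact .inl (by simp [q.getVert_of_length_le ht, q.getVert_of_length_le (ht.trans t.le_succ)])
    · exact .inl (by simp [hi])
  · simp [q.getVert_of_length_le (show q.length ≤ 2 * q.length by omega)]

theorem Sweeps.of_guard (hT : T.IsTree) {w : V} {F : Set (Set V)}
    (h : Sweeps T (d + 1) (fun c => c 0 = w) F) : Sweeps T (d + 1) (fun _ => True) F := by
  intro c₀ _
  obtain ⟨n, c, hc0, hc, hcw⟩ := exists_lazyWalk_to hT c₀ w
  obtain ⟨n', c', hc0', hc', -, hcatch'⟩ := h (c (2 * n)) hcw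
  refine ⟨n + n', splice (2 * n) c c', ?_, isLazyWalk_splice hc0' hc hc', fun _ => trivial, ?_⟩
  · rw [splice_of_le _ _ (Nat.zero_le _), hc0]
  · intro r hr A hA hrA
    rw [mul_add]
    exact (hcatch' _ (hr.shift _) A hA fun t ht => hrA _ (by omega)).splice_right hc0'

/-- A cop alternating between `w` and `v` shuts the robber into the branch of a child of `v`,
where the remaining cops catch him. -/
theorem Sweeps.guard_child (hT : T.IsTree) {w v : V} (hwv : T.Adj w v)
    (h : Sweeps T d (fun _ => True) {B | ∃ x, T.Adj v x ∧ x ≠ w ∧ B = branch T v x}) :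
    Sweeps T (d + 1) (fun c => c 0 = w) {branch T w v} := by
  intro c₀ h₀
  obtain ⟨n, c, hc0, hc, -, hcatch⟩ := h (Fin.tail c₀) trivial
  refine ⟨n + 1, fun t => Fin.cons (if Even t then w else v) (c t), ?_, ?_, by simp, ?_⟩
  · simp [hc0, ← h₀]
  · intro i t
    refine Fin.cases ?_ (fun i => ?_) i
    · by_cases ht : Even t <;> simp [ht, Nat.even_add_one, hwv, hwv.symm]
    · simpa using hc i t
  · rintro r hr _ rfl hrB
    by_contra hcon
    have hv : ∀ t < 2 * (n + 1), r t ≠ v := by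
      rintro t ht rfl
      refine hcon ⟨t, ht, 0, ?_⟩
      by_cases ht : Even t
      · right; simp [ht, Nat.even_add_one]
      · left; simp [ht]
    obtain ⟨x, hx, hxw, hrx⟩ := exists_child_forall_mem hT hr (by omega) hrB hv
    obtain ⟨t, ht, i, hi⟩ := hcatch r hr _ ⟨x, hx, hxw, rfl⟩ fun t ht => hrx t (by omega)
    exact hcon ⟨t, by omega, i.succ, by simpa using hi⟩

theorem Sweeps.guard_root (hT : T.IsTree) {p w : V}
    (h : Sweeps T (d + 1) (fun c => c 0 = w) {B | ∃ v, T.Adj w v ∧ v ≠ p ∧ B = branch T w v}) :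
    Sweeps T (d + 1) (fun c => c 0 = w) {branch T p w} := by
  intro c₀ h₀
  obtain ⟨n, c, hc0, hc, hQ, hcatch⟩ := h c₀ h₀
  refine ⟨n + 1, c, hc0, hc, hQ, ?_⟩
  rintro r hr _ rfl hrB
  by_contra hcon
  obtain ⟨v, hv, hvp, hrv⟩ :=
    exists_child_forall_mem hT hr (by omega) hrB (ne_of_not_caught hQ hcon)
  exact hcon ((hcatch r hr _ ⟨v, hv, hvp, rfl⟩ fun t ht => hrv t (by omega)).mono (by omega))

theorem sweeps_guard_branch_of_sweeps_branch [Finite V] (hT : T.IsTree) {m : ℕ}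
    (ih : ∀ p w, T.Adj p w → (∀ x ∈ branch T p w, T.dist x w < 2 * m) →
      Sweeps T m (fun _ => True) {branch T p w}) {p w : V} (hpw : T.Adj p w)
    (h : ∀ x ∈ branch T p w, T.dist x w < 2 * (m + 1)) :
    Sweeps T (m + 1) (fun c => c 0 = w) {branch T p w} := by
  refine Sweeps.guard_root hT (sweeps_of_forall ?_)
  rintro _ ⟨v, hwv, hvp, rfl⟩
  refine Sweeps.guard_child hT hwv (sweeps_of_forall ?_)
  rintro _ ⟨x, hvx, hxw, rfl⟩
  refine ih v x hvx fun y hy => ?_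
  have hy' := branch_child_subset hT hwv hvx hxw hy
  have := h y (branch_child_subset hT hpw hwv hvp hy')
  rw [mem_branch] at hy hy'
  omega

theorem sweeps_branch [Finite V] (hT : T.IsTree) (m : ℕ) :
    ∀ p w, T.Adj p w → (∀ x ∈ branch T p w, T.dist x w < 2 * m) →
      Sweeps T m (fun _ => True) {branch T p w} := by
  induction m with
  | zero =>
    intro p w h hB
    have hw : w ∈ branch T p w := by
      rw [mem_branch, dist_self, dist_eq_one_iff_adj.2 h.symm]
    exact absurd (hB w hw) (by simp)
  | succ m ih =>
    exact fun p w h hB => (sweeps_guard_branch_of_sweeps_branch hT ih h hB).of_guard hT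

/-- If both branches at an edge can be swept by a team guarding the root, then the whole tree can
be searched by that team. -/
theorem exists_forall_caught (hT : T.IsTree) {u v : V} (huv : T.Adj u v)
    (hu : Sweeps T (d + 1) (fun c => c 0 = u) {branch T v u})
    (hv : Sweeps T (d + 1) (fun c => c 0 = v) {branch T u v}) :
    ∃ (n : ℕ) (c : ℕ → Fin (d + 1) → V), (∀ i, IsLazyWalk T fun t => c t i) ∧
      ∀ r, IsLazyWalk T r → Caught c r n := by
  obtain ⟨n, c, hc0, hc, hcu, hcatch⟩ := hu (fun _ => u) rfl
  obtain ⟨n', c', hc0', hc', hcv, hcatch'⟩ := hv (Function.update (c (2 * n)) 0 v) (by simp)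
  let g : ℕ → Fin (d + 1) → V := fun t => Nat.casesOn t (c (2 * n)) c'
  have hg : ∀ i, IsLazyWalk T fun t => g t i := by
    rintro i (_ | t)
    · rcases eq_or_ne i 0 with rfl | hi
      · exact .inr (by simpa [g, hc0', hcu n] using huv)
      · exact .inl (by simp [g, hc0', hi])
    · exact hc' i t
  have hg0 : g 0 = c (2 * n) := rfl
  refine ⟨2 * n + (2 * n' + 1), splice (2 * n) c g, isLazyWalk_splice hg0 hc hg, fun r hr => ?_⟩
  by_contra hcon
  have hc1 : ¬ Caught c r (2 * n) := fun h => hcon ((h.splice_left g).mono (by omega))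
  have hc2 : ¬ Caught g (fun t => r (2 * n + t)) (2 * n' + 1) :=
    fun h => hcon (h.splice_right hg0)
  have hc3 : ¬ Caught c' (fun t => r (2 * n + 1 + t)) (2 * n') := by
    rintro ⟨t, ht, i, hi⟩
    beta_reduce at hi
    rw [add_assoc, add_comm 1 t] at hi
    exact hc2 ⟨t + 1, by omega, i, hi⟩
  have hru : ∀ t < 2 * n + 1, r t ≠ u := by
    intro t ht
    rcases Nat.lt_succ_iff_lt_or_eq.1 ht with h | rfl
    · exact ne_of_not_caught hcu hc1 t h
    · exact fun h => hc2 ⟨0, by omega, 0, .inl ((congrFun hg0 0).trans ((hcu n).trans h.symm))⟩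
  have hrv : r (2 * n) ≠ v := fun h =>
    hc2 ⟨0, by omega, 0, .inr (by simp [g, hc0', h])⟩
  rcases mem_branch_or hT huv (r 0) with h0 | h0
  · have h1 := mem_branch_of_ne_parent hT huv hr h0 hru (2 * n) (by omega)
    have h2 := mem_branch_of_ne hT huv (hr.shift (2 * n)) h1 (n := 1)
      (fun t ht => by rwa [Nat.lt_one_iff.1 ht]) 1 le_rfl
    exact hc3 (hcatch' _ (hr.shift _) _ rfl fun t ht =>
      mem_branch_of_ne hT huv (hr.shift _) h2 (ne_of_not_caught hcv hc3) t ht.le)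
  · exact hc1 (hcatch r hr _ rfl fun t ht =>
      mem_branch_of_ne hT huv.symm hr h0 (fun t ht => hru t (by omega)) t ht.le)

/-- On a tree, `⌊diam / 4⌋ + 1` cops catch an invisible robber by following a fixed sequence of
positions. -/
theorem exists_search [Finite V] (hT : T.IsTree) :
    ∃ (n : ℕ) (c : ℕ → Fin (T.diam / 4 + 1) → V), (∀ i, IsLazyWalk T fun t => c t i) ∧
      ∀ r, IsLazyWalk T r → Caught c r n := by
  by_cases hD : T.diam = 0
  · obtain ⟨a⟩ := hT.connected.nonempty
    have hV : Subsingleton V := by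
      by_contra h
      have := not_subsingleton_iff_nontrivial.1 h
      exact diam_ne_zero_of_ediam_ne_top (connected_iff_ediam_ne_top.1 hT.connected) hD
    exact ⟨1, fun _ _ => a, fun _ _ => .inl rfl,
      fun r _ => ⟨0, one_pos, 0, .inl (Subsingleton.elim _ _)⟩⟩
  · obtain ⟨u, v, huv, hu, hv⟩ := exists_central_edge hT hD
    refine exists_forall_caught hT huv ?_ ?_
    · refine sweeps_guard_branch_of_sweeps_branch hT (sweeps_branch hT _) huv.symm fun x hx => ?_
      have := hu x hx
      omega
    · refine sweeps_guard_branch_of_sweeps_branch hT (sweeps_branch hT _) huv fun x hx => ?_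
      have := hv x hx
      omega

end Sweeps

section Strategy

variable {V : Type} {T : SimpleGraph V} {d : ℕ}

open Classical in
/-- The strategy of following a fixed sequence of positions. -/
noncomputable def CopStrategy.ofSeq (c : ℕ → Fin d → V) : CopStrategy V d where
  init := c 0
  move h p := if p = c (h.length - 1) then c h.length else p

theorem CopStrategy.ofSeq_legal {c : ℕ → Fin d → V} (hc : ∀ i, IsLazyWalk T fun t => c t i) :
    (CopStrategy.ofSeq c).Legal T := by
  intro h p i
  simp only [CopStrategy.ofSeq]
  split_ifs with hp
  · subst hp
    rcases h with _ | ⟨o, h⟩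
    · exact .inl rfl
    · exact hc i h.length
  · exact .inl rfl

theorem length_observations (vis : (Fin d → V) → V → Prop) (S : CopStrategy V d)
    (R : RobberStrategy V d) (n : ℕ) : (play vis S R n).2.1.length = n := by
  induction n with
  | zero => rfl
  | succ n ih => simp [play, ih]

theorem copPos_ofSeq (vis : (Fin d → V) → V → Prop) (c : ℕ → Fin d → V)
    (R : RobberStrategy V d) (n : ℕ) : copPos vis (CopStrategy.ofSeq c) R n = c n := by
  induction n with
  | zero => rfl
  | succ n ih =>
    have hlen := length_observations vis (CopStrategy.ofSeq c) R n
    have hpos : (play vis (CopStrategy.ofSeq c) R n).1.1 = c n := ih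
    change (CopStrategy.ofSeq c).move (_ :: _) _ = _
    simp only [CopStrategy.ofSeq] at hlen hpos ⊢
    rw [List.length_cons, hlen, hpos, Nat.add_sub_cancel, if_pos rfl]

theorem isLazyWalk_robPos (vis : (Fin d → V) → V → Prop) (S : CopStrategy V d)
    {R : RobberStrategy V d} (hR : R.Legal T) : IsLazyWalk T (robPos vis S R) :=
  fun _ => hR _ _ _

theorem winningCopStrategy_ofSeq (vis : (Fin d → V) → V → Prop) {n : ℕ} {c : ℕ → Fin d → V}
    (hc : ∀ i, IsLazyWalk T fun t => c t i) (h : ∀ r, IsLazyWalk T r → Caught c r n) :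
    WinningCopStrategy T vis (CopStrategy.ofSeq c) := by
  refine ⟨CopStrategy.ofSeq_legal hc, fun R hR => ?_⟩
  obtain ⟨t, -, i, hi⟩ := h _ (isLazyWalk_robPos vis (CopStrategy.ofSeq c) hR)
  exact ⟨t, i, by simpa only [copPos_ofSeq] using hi⟩

end Strategy

/-- If `T` is a finite tree and `k ≥ 1`, then `c_{H,k}(T) ≤ ⌊diam(T)/4⌋ + 1`. -/
theorem stmt16 {V : Type} [Fintype V] (T : SimpleGraph V) (hT : T.IsTree)
    (k : ℕ) (hk : 1 ≤ k) :
    hyperopicCopNumber T k ≤ T.diam / 4 + 1 := by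
  obtain ⟨n, c, hc, h⟩ := exists_search hT
  exact Nat.sInf_le ⟨_, winningCopStrategy_ofSeq _ hc h⟩

end CopsRobber
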